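/- arXiv:1003.2556 — 3 statements merged into one kernel-verified Lean document; each statement's English description precedes it below -/
import Mathlib

section
/- Define I(f,k) = −(n+1)(n+2) ∫_{[0,1]^n} f(x)·(x_{(k+1)} − 2x_{(k)} + x_{(k−1)}) dx. For the coordinate projection f(x) = x_i (any fixed i ∈ {1,...,n}) and every k ∈ {1,...,n}, I(f,k) = 1/n. -/
open MeasureTheory Finset

/-- The `k`-th order statistic of `x : Fin n → ℝ`, with conventions
`oStat x 0 = 0` and `oStat x k = 1` for `k > n`. For `1 ≤ k ≤ n` it is the
`k`-th smallest coordinate of `x`. -/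
noncomputable def oStat {n : ℕ} (x : Fin n → ℝ) (k : ℕ) : ℝ :=
  if k = 0 then 0
  else if k ≤ n then ((Finset.univ.val.map x).sort (· ≤ ·)).getD (k - 1) 0
  else 1

/-- The `k`-th order statistic of the subfamily `(x i)_{i ∈ S}`. -/
noncomputable def oStatS {n : ℕ} (S : Finset (Fin n)) (x : Fin n → ℝ) (k : ℕ) : ℝ :=
  ((S.val.map x).sort (· ≤ ·)).getD (k - 1) 0

/-- The influence index `I(f,k)` of the `k`-th largest variable on `f`. -/
noncomputable def infl {n : ℕ} (f : (Fin n → ℝ) → ℝ) (k : ℕ) : ℝ :=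
  -((n:ℝ)+1)*((n:ℝ)+2) * ∫ x in Set.Icc (0:Fin n → ℝ) 1,
    f x * (oStat x (k+1) - 2*oStat x k + oStat x (k-1))

theorem Multiset.sort_cons_eq_orderedInsert (t : ℝ) (s : Multiset ℝ) :
    (t ::ₘ s).sort (· ≤ ·) = (s.sort (· ≤ ·)).orderedInsert (· ≤ ·) t := by
  refine List.Perm.eq_of_pairwise' (Multiset.pairwise_sort _ _)
    ((Multiset.pairwise_sort s _).orderedInsert t _) ?_
  rw [← Multiset.coe_eq_coe, Multiset.sort_eq,
    Multiset.coe_eq_coe.2 (List.perm_orderedInsert _ t _), ← Multiset.cons_coe, Multiset.sort_eq]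

theorem List.getD_mono_of_pairwise {l : List ℝ} (hl : l.Pairwise (· ≤ ·)) (d : ℝ) {j k : ℕ}
    (hjk : j ≤ k) (hk : k < l.length) : l.getD j d ≤ l.getD k d := by
  rw [List.getD_eq_getElem _ _ (hjk.trans_lt hk), List.getD_eq_getElem _ _ hk]
  rcases hjk.eq_or_lt with rfl | h
  · exact le_rfl
  · exact List.pairwise_iff_getElem.1 hl j k (hjk.trans_lt hk) hk h

/-- Inserting `t` into a sorted list clamps `t` between consecutive entries. -/
theorem List.getD_orderedInsert (t hi d : ℝ) (hhi : t ≤ hi) (s : List ℝ) :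
    ∀ (lo : ℝ) (k : ℕ), (lo :: (s ++ [hi])).Pairwise (· ≤ ·) → lo ≤ t → k ≤ s.length →
      (lo :: (s.orderedInsert (· ≤ ·) t ++ [hi])).getD (k + 1) d =
        max ((lo :: (s ++ [hi])).getD k d) (min t ((lo :: (s ++ [hi])).getD (k + 1) d)) := by
  induction s with
  | nil =>
    intro lo k _ hlo hk
    obtain rfl : k = 0 := by simpa using hk
    simp [hhi, hlo]
  | cons a s ih =>
    intro lo k hs hlo hk
    have hs' := (List.pairwise_cons.1 hs).2
    rw [List.cons_append] at hs'
    rw [List.orderedInsert_cons]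
    split_ifs with hta
    · rcases k with _ | k
      · simp [hta, hlo]
      · have h : (a :: (s ++ [hi])).getD 0 d ≤ (a :: (s ++ [hi])).getD k d :=
          List.getD_mono_of_pairwise hs' d (Nat.zero_le k) (by simp at hk ⊢; omega)
        simp only [List.cons_append, List.getD_cons_succ, List.getD_cons_zero] at h ⊢
        exact (max_eq_left ((min_le_left _ _).trans (hta.trans h))).symm
    · rw [not_le] at hta
      rcases k with _ | k
      · have : lo ≤ a := (List.pairwise_cons.1 hs).1 a (by simp)
        simp [hta.le, this]
      · have := ih a k hs' hta.le (by simpa using hk)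
        simpa only [List.cons_append, List.getD_cons_succ] using this

theorem oStat_zero {n : ℕ} (x : Fin n → ℝ) : oStat x 0 = 0 := by simp [oStat]

theorem oStat_of_lt {n : ℕ} (x : Fin n → ℝ) {k : ℕ} (hk : n < k) : oStat x k = 1 := by
  rw [oStat, if_neg (by omega), if_neg (by omega)]

theorem oStat_eq_getD {n : ℕ} (x : Fin n → ℝ) {k : ℕ} (hk : k ≤ n + 1) :
    oStat x k = (0 :: ((univ.val.map x).sort (· ≤ ·) ++ [1])).getD k 0 := by
  have hl : ((univ.val.map x).sort (· ≤ ·)).length = n := by simp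
  rcases k with _ | k
  · simp [oStat]
  · rw [List.getD_cons_succ, oStat, if_neg (Nat.succ_ne_zero k)]
    split_ifs with h
    · rw [List.getD_append _ _ _ _ (by omega), Nat.add_sub_cancel]
    · rw [List.getD_append_right _ _ _ _ (by omega), hl, show k - n = 0 by omega]
      rfl

theorem pairwise_sort_extend {n : ℕ} {x : Fin n → ℝ} (hx : x ∈ Set.Icc (0 : Fin n → ℝ) 1) :
    (0 :: ((univ.val.map x).sort (· ≤ ·) ++ [1])).Pairwise (· ≤ ·) := by
  have hmem : ∀ a ∈ (univ.val.map x).sort (· ≤ ·), 0 ≤ a ∧ a ≤ 1 := by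
    intro a ha
    rw [Multiset.mem_sort, Multiset.mem_map] at ha
    obtain ⟨j, -, rfl⟩ := ha
    exact ⟨hx.1 j, hx.2 j⟩
  rw [List.pairwise_cons, List.pairwise_append]
  refine ⟨fun a ha => ?_, Multiset.pairwise_sort _ _, List.pairwise_singleton _ _, ?_⟩
  · rcases List.mem_append.1 ha with ha | ha
    · exact (hmem a ha).1
    · rw [List.mem_singleton.1 ha]; exact zero_le_one
  · intro a ha b hb
    rw [List.mem_singleton.1 hb]
    exact (hmem a ha).2

theorem oStat_mono {n : ℕ} {x : Fin n → ℝ} (hx : x ∈ Set.Icc (0 : Fin n → ℝ) 1) {j k : ℕ}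
    (hjk : j ≤ k) (hk : k ≤ n + 1) : oStat x j ≤ oStat x k := by
  rw [oStat_eq_getD x (hjk.trans hk), oStat_eq_getD x hk]
  exact List.getD_mono_of_pairwise (pairwise_sort_extend hx) 0 hjk (by simp; omega)

theorem oStat_nonneg {n : ℕ} {x : Fin n → ℝ} (hx : x ∈ Set.Icc (0 : Fin n → ℝ) 1) {k : ℕ}
    (hk : k ≤ n + 1) : 0 ≤ oStat x k :=
  (oStat_zero x).symm.le.trans (oStat_mono hx (Nat.zero_le k) hk)

theorem oStat_le_one {n : ℕ} {x : Fin n → ℝ} (hx : x ∈ Set.Icc (0 : Fin n → ℝ) 1) {k : ℕ}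
    (hk : k ≤ n + 1) : oStat x k ≤ 1 :=
  (oStat_mono hx hk le_rfl).trans (oStat_of_lt x n.lt_succ_self).le

/-- The order statistics of a point of the cube in terms of one coordinate `t` and the order
statistics of the remaining coordinates `y`. -/
theorem oStat_insertNth {m : ℕ} (i : Fin (m + 1)) {t : ℝ} (ht : t ∈ Set.Icc (0 : ℝ) 1)
    {y : Fin m → ℝ} (hy : y ∈ Set.Icc (0 : Fin m → ℝ) 1) {k : ℕ} (hk : k ≤ m) :
    oStat (i.insertNth t y : Fin (m + 1) → ℝ) (k + 1) =
      max (oStat y k) (min t (oStat y (k + 1))) := by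
  have hmap : univ.val.map (i.insertNth t y : Fin (m + 1) → ℝ) = t ::ₘ univ.val.map y := by
    rw [Fin.univ_succAbove m i]
    simp [Function.comp_def]
  rw [oStat_eq_getD _ (by omega), oStat_eq_getD y (by omega), oStat_eq_getD y (by omega), hmap,
    Multiset.sort_cons_eq_orderedInsert]
  exact List.getD_orderedInsert t 1 0 ht.2 _ 0 k (pairwise_sort_extend hy) ht.1 (by simpa using hk)

theorem continuousOn_oStat (n k : ℕ) :
    ContinuousOn (fun x : Fin n → ℝ => oStat x k) (Set.Icc 0 1) := by
  induction n generalizing k with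
  | zero =>
    rcases k with _ | k
    · simpa only [oStat_zero] using continuousOn_const
    · simpa only [oStat_of_lt _ k.succ_pos] using continuousOn_const
  | succ m ih =>
    rcases k with _ | k
    · simpa only [oStat_zero] using continuousOn_const
    rcases lt_or_ge m k with h | h
    · simpa only [oStat_of_lt _ (Nat.succ_lt_succ h)] using continuousOn_const
    have htail : ContinuousOn (fun x : Fin (m + 1) → ℝ => Fin.tail x) (Set.Icc 0 1) :=
      Continuous.continuousOn (by unfold Fin.tail; fun_prop)
    have hmaps : Set.MapsTo (fun x : Fin (m + 1) → ℝ => Fin.tail x) (Set.Icc 0 1) (Set.Icc 0 1) :=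
      fun x hx => ⟨fun j => hx.1 j.succ, fun j => hx.2 j.succ⟩
    refine ContinuousOn.congr (f := fun x : Fin (m + 1) → ℝ =>
      max (oStat (Fin.tail x) k) (min (x 0) (oStat (Fin.tail x) (k + 1))))
      (ContinuousOn.sup ((ih k).comp htail hmaps) (ContinuousOn.inf
        (continuous_apply (0 : Fin (m + 1))).continuousOn
          ((ih (k + 1)).comp htail hmaps))) fun x hx => ?_
    have h0 := oStat_insertNth (0 : Fin (m + 1)) (t := x 0) ⟨hx.1 0, hx.2 0⟩ (hmaps hx) h
    rwa [Fin.insertNth_zero', Fin.cons_self_tail] at h0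

/-- Integration over the cube, one coordinate first. -/
theorem setIntegral_cube_succ {m : ℕ} (i : Fin (m + 1)) {F : (Fin (m + 1) → ℝ) → ℝ}
    (hF : ContinuousOn F (Set.Icc 0 1)) :
    ∫ x in Set.Icc (0 : Fin (m + 1) → ℝ) 1, F x =
      ∫ y in Set.Icc (0 : Fin m → ℝ) 1, ∫ t in Set.Icc (0 : ℝ) 1, F (i.insertNth t y) := by
  have hmem : ∀ z : (Fin m → ℝ) × ℝ, z ∈ Set.Icc (0 : Fin m → ℝ) 1 ×ˢ Set.Icc (0 : ℝ) 1 →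
      (i.insertNth z.2 z.1 : Fin (m + 1) → ℝ) ∈ Set.Icc (0 : Fin (m + 1) → ℝ) 1 :=
    fun z hz => Fin.insertNth_mem_Icc.2 ⟨hz.2, hz.1⟩
  have hcont : ContinuousOn (fun z : (Fin m → ℝ) × ℝ => F (i.insertNth z.2 z.1))
      (Set.Icc (0 : Fin m → ℝ) 1 ×ˢ Set.Icc (0 : ℝ) 1) :=
    hF.comp (Continuous.finInsertNth (A := fun _ => ℝ) i continuous_snd continuous_fst).continuousOn hmem
  rw [← setIntegral_prod (fun z : (Fin m → ℝ) × ℝ => F (i.insertNth z.2 z.1))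
    (hcont.integrableOn_compact (isCompact_Icc.prod isCompact_Icc)), ← setIntegral_prod_swap]
  have key := (volume_preserving_piFinSuccAbove (fun _ : Fin (m + 1) => ℝ)
    i).setIntegral_preimage_emb (MeasurableEquiv.measurableEmbedding _)
    (fun z => F (i.insertNth z.1 z.2)) (Set.Icc (0 : ℝ) 1 ×ˢ Set.Icc (0 : Fin m → ℝ) 1)
  refine Eq.trans ?_ key
  have hset : (MeasurableEquiv.piFinSuccAbove (fun _ : Fin (m + 1) => ℝ) i) ⁻¹'
      (Set.Icc (0 : ℝ) 1 ×ˢ Set.Icc (0 : Fin m → ℝ) 1) = Set.Icc 0 1 := by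
    ext x
    conv_rhs => rw [← Fin.insertNth_self_removeNth i x, Fin.insertNth_mem_Icc]
    exact Iff.rfl
  rw [hset]
  refine integral_congr_ae (ae_of_all _ fun x => ?_)
  simp [MeasurableEquiv.piFinSuccAbove, Fin.insertNthEquiv]

theorem integral_clamp {G : ℝ → ℝ → ℝ} (hG : Continuous (Function.uncurry G)) {a b : ℝ}
    (ha : 0 ≤ a) (hab : a ≤ b) (hb : b ≤ 1) :
    ∫ t in Set.Icc (0 : ℝ) 1, G t (max a (min t b)) =
      (∫ t in (0 : ℝ)..a, G t a) + (∫ t in a..b, G t t) + ∫ t in b..1, G t b := by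
  have hc : Continuous fun t => G t (max a (min t b)) :=
    hG.comp (continuous_id.prodMk (continuous_const.max (continuous_id.min continuous_const)))
  rw [integral_Icc_eq_integral_Ioc, ← intervalIntegral.integral_of_le zero_le_one,
    ← intervalIntegral.integral_add_adjacent_intervals (hc.intervalIntegrable 0 b)
      (hc.intervalIntegrable b 1),
    ← intervalIntegral.integral_add_adjacent_intervals (hc.intervalIntegrable 0 a)
      (hc.intervalIntegrable a b)]
  congr 1
  · congr 1
    · refine intervalIntegral.integral_congr fun t ht => ?_
      rw [Set.uIcc_of_le ha] at ht
      simp only [max_eq_left ((min_le_left t b).trans ht.2)]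
    · refine intervalIntegral.integral_congr fun t ht => ?_
      rw [Set.uIcc_of_le hab] at ht
      simp only [min_eq_left ht.2, max_eq_right ht.1]
  · refine intervalIntegral.integral_congr fun t ht => ?_
    rw [Set.uIcc_of_le hb] at ht
    simp only [min_eq_right ht.1, max_eq_right hab]

theorem integral_clamp_pow {a b : ℝ} (ha : 0 ≤ a) (hab : a ≤ b) (hb : b ≤ 1) (p : ℕ) :
    ∫ t in Set.Icc (0 : ℝ) 1, max a (min t b) ^ p =
      b ^ p - p / (p + 1) * (b ^ (p + 1) - a ^ (p + 1)) := by
  rw [integral_clamp (G := fun _ s => s ^ p) (by fun_prop) ha hab hb]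
  simp only [intervalIntegral.integral_const, integral_pow, smul_eq_mul]
  field_simp
  ring

theorem integral_mul_clamp {a b : ℝ} (ha : 0 ≤ a) (hab : a ≤ b) (hb : b ≤ 1) :
    ∫ t in Set.Icc (0 : ℝ) 1, t * max a (min t b) = b / 2 - (b ^ 3 - a ^ 3) / 6 := by
  rw [integral_clamp (G := fun t s => t * s) (by fun_prop) ha hab hb]
  simp only [← pow_two, intervalIntegral.integral_mul_const, integral_pow, integral_id]
  ring

theorem integrableOn_oStat_pow (n k p : ℕ) :
    IntegrableOn (fun x : Fin n → ℝ => oStat x k ^ p) (Set.Icc 0 1) :=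
  ((continuousOn_oStat n k).pow p).integrableOn_compact isCompact_Icc

theorem volume_real_cube (n : ℕ) : volume.real (Set.Icc (0 : Fin n → ℝ) 1) = 1 := by
  simp [Measure.real, Real.volume_Icc_pi]

/-- The moments of the order statistics of independent uniform variables. -/
theorem setIntegral_oStat_pow (n k p : ℕ) (hp : p ≠ 0) (hk : k ≤ n + 1) :
    ∫ x in Set.Icc (0 : Fin n → ℝ) 1, oStat x k ^ p =
      (k.ascFactorial p : ℝ) / ((n + 1).ascFactorial p : ℝ) := by
  have hpos : ∀ j q : ℕ, ((j + 1).ascFactorial q : ℝ) ≠ 0 := fun j q =>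
    Nat.cast_ne_zero.2 (Nat.ascFactorial_pos j q).ne'
  have hzero : ∀ n p : ℕ, p ≠ 0 → ∫ x in Set.Icc (0 : Fin n → ℝ) 1, oStat x 0 ^ p =
      ((0 : ℕ).ascFactorial p : ℝ) / ((n + 1).ascFactorial p : ℝ) := by
    intro n p hp
    obtain ⟨q, rfl⟩ := Nat.exists_eq_succ_of_ne_zero hp
    simp [oStat_zero, Nat.zero_ascFactorial]
  have hone : ∀ n p : ℕ, ∫ x in Set.Icc (0 : Fin n → ℝ) 1, oStat x (n + 1) ^ p =
      ((n + 1).ascFactorial p : ℝ) / ((n + 1).ascFactorial p : ℝ) := by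
    intro n p
    rw [div_self (hpos n p)]
    simp [oStat_of_lt _ n.lt_succ_self, volume_real_cube]
  induction n generalizing k p with
  | zero =>
    interval_cases k
    · exact hzero 0 p hp
    · exact hone 0 p
  | succ m ih =>
    rcases k with _ | j
    · exact hzero (m + 1) p hp
    rcases Nat.lt_or_ge m j with hj | hj
    · obtain rfl : j = m + 1 := by omega
      exact hone (m + 1) p
    have hinner : ∀ y ∈ Set.Icc (0 : Fin m → ℝ) 1,
        ∫ t in Set.Icc (0 : ℝ) 1, oStat ((0 : Fin (m + 1)).insertNth t y : Fin (m + 1) → ℝ)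
          (j + 1) ^ p =
        oStat y (j + 1) ^ p -
          p / (p + 1) * (oStat y (j + 1) ^ (p + 1) - oStat y j ^ (p + 1)) := by
      intro y hy
      rw [← integral_clamp_pow (oStat_nonneg hy (by omega)) (oStat_mono hy j.le_succ (by omega))
        (oStat_le_one hy (by omega)) p]
      exact setIntegral_congr_fun measurableSet_Icc fun t ht => by
        simp only [oStat_insertNth 0 ht hy hj]
    have hA : ((j + 1).ascFactorial (p + 1) : ℝ) = (j + 1 + p) * (j + 1).ascFactorial p := by
      exact_mod_cast Nat.ascFactorial_succ (n := j + 1) (k := p)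
    have hB : (j.ascFactorial (p + 1) : ℝ) = j * (j + 1).ascFactorial p := by
      rw [Nat.ascFactorial_succ, ← Nat.succ_ascFactorial]; push_cast; rfl
    have hC : ((m + 1).ascFactorial (p + 1) : ℝ) = (m + 1 + p) * (m + 1).ascFactorial p := by
      exact_mod_cast Nat.ascFactorial_succ (n := m + 1) (k := p)
    have hD : ((m : ℝ) + 1) * (m + 1 + 1).ascFactorial p =
        (m + 1 + p) * (m + 1).ascFactorial p := by
      exact_mod_cast Nat.succ_ascFactorial (m + 1) p
    have hD' : ((m + 1 + 1).ascFactorial p : ℝ) =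
        (m + 1 + p) * (m + 1).ascFactorial p / (m + 1) := by
      rw [← hD]; field_simp
    have hsub : IntegrableOn (fun y : Fin m → ℝ => oStat y (j + 1) ^ (p + 1) - oStat y j ^ (p + 1))
        (Set.Icc 0 1) :=
      (integrableOn_oStat_pow _ _ _).sub (integrableOn_oStat_pow _ _ _)
    rw [setIntegral_cube_succ (F := fun x => oStat x (j + 1) ^ p) 0 ((continuousOn_oStat _ _).pow p),
      setIntegral_congr_fun measurableSet_Icc hinner,
      integral_sub (integrableOn_oStat_pow _ _ _) (hsub.const_mul _),
      integral_const_mul,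
      integral_sub (integrableOn_oStat_pow _ _ _) (integrableOn_oStat_pow _ _ _),
      ih (j + 1) p hp (by omega), ih (j + 1) (p + 1) (by omega) (by omega),
      ih j (p + 1) (by omega) (by omega), hA, hB, hC, hD']
    have := hpos m p
    field_simp
    ring

theorem setIntegral_mul_oStat {m : ℕ} (i : Fin (m + 1)) {k : ℕ} (hk : k ≤ m + 2) :
    ∫ x in Set.Icc (0 : Fin (m + 1) → ℝ) 1, x i * oStat x k =
      k / (2 * (m + 1)) - k * (k + 1) / (2 * (m + 1) * (m + 2) * (m + 3)) := by
  rcases k with _ | j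
  · simp [oStat_zero]
  rcases Nat.lt_or_ge m j with hj | hj
  · obtain rfl : j = m + 1 := by omega
    simp only [oStat_of_lt _ (m + 1).lt_succ_self, mul_one]
    rw [setIntegral_cube_succ i (continuous_apply i).continuousOn]
    simp only [Fin.insertNth_apply_same, integral_Icc_eq_integral_Ioc,
      ← intervalIntegral.integral_of_le zero_le_one, integral_id, setIntegral_const,
      volume_real_cube]
    push_cast
    simp only [smul_eq_mul]
    field_simp
    ring
  have hinner : ∀ y ∈ Set.Icc (0 : Fin m → ℝ) 1,
      ∫ t in Set.Icc (0 : ℝ) 1, (i.insertNth t y : Fin (m + 1) → ℝ) i *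
        oStat (i.insertNth t y : Fin (m + 1) → ℝ) (j + 1) =
      oStat y (j + 1) ^ 1 / 2 - (oStat y (j + 1) ^ 3 - oStat y j ^ 3) / 6 := by
    intro y hy
    rw [pow_one, ← integral_mul_clamp (oStat_nonneg hy (by omega))
      (oStat_mono hy j.le_succ (by omega)) (oStat_le_one hy (by omega))]
    exact setIntegral_congr_fun measurableSet_Icc fun t ht => by
      simp only [oStat_insertNth i ht hy hj, Fin.insertNth_apply_same]
  have hsub : IntegrableOn (fun y : Fin m → ℝ => oStat y (j + 1) ^ 3 - oStat y j ^ 3)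
      (Set.Icc 0 1) :=
    (integrableOn_oStat_pow _ _ _).sub (integrableOn_oStat_pow _ _ _)
  rw [setIntegral_cube_succ (F := fun x => x i * oStat x (j + 1)) i
    ((continuous_apply i).continuousOn.mul (continuousOn_oStat _ _)),
    setIntegral_congr_fun measurableSet_Icc hinner,
    integral_sub ((integrableOn_oStat_pow _ _ _).div_const _) (hsub.div_const _),
    integral_div, integral_div,
    integral_sub (integrableOn_oStat_pow _ _ _) (integrableOn_oStat_pow _ _ _),
    setIntegral_oStat_pow m _ _ one_ne_zero (by omega),
    setIntegral_oStat_pow m _ _ three_ne_zero (by omega),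
    setIntegral_oStat_pow m _ _ three_ne_zero (by omega)]
  have h_one : ∀ a : ℕ, a.ascFactorial 1 = a := fun a => by simp [Nat.ascFactorial]
  have h_three : ∀ a : ℕ, a.ascFactorial 3 = (a + 2) * ((a + 1) * a) := fun a => by
    simp [Nat.ascFactorial]
  simp only [h_one, h_three]
  push_cast
  field_simp
  ring

theorem stmt11 (n : ℕ) (i : Fin n) (k : ℕ) (hk : 1 ≤ k) (hkn : k ≤ n) :
    infl (fun x : Fin n → ℝ => x i) k = 1 / (n : ℝ) := by
  obtain ⟨m, rfl⟩ : ∃ m, n = m + 1 := ⟨n - 1, by omega⟩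
  obtain ⟨k, rfl⟩ : ∃ j, k = j + 1 := ⟨k - 1, by omega⟩
  have hint : ∀ j, IntegrableOn (fun x : Fin (m + 1) → ℝ => x i * oStat x j) (Set.Icc 0 1) :=
    fun j => ((continuous_apply i).continuousOn.mul
      (continuousOn_oStat _ j)).integrableOn_compact isCompact_Icc
  have hsplit : ∫ x in Set.Icc (0 : Fin (m + 1) → ℝ) 1,
      x i * (oStat x (k + 1 + 1) - 2 * oStat x (k + 1) + oStat x (k + 1 - 1)) =
      (∫ x in Set.Icc (0 : Fin (m + 1) → ℝ) 1, x i * oStat x (k + 2)) -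
        2 * (∫ x in Set.Icc (0 : Fin (m + 1) → ℝ) 1, x i * oStat x (k + 1)) +
        ∫ x in Set.Icc (0 : Fin (m + 1) → ℝ) 1, x i * oStat x k := by
    have hsub : IntegrableOn (fun x : Fin (m + 1) → ℝ =>
        x i * oStat x (k + 2) - 2 * (x i * oStat x (k + 1))) (Set.Icc 0 1) :=
      (hint _).sub ((hint _).const_mul 2)
    rw [← integral_const_mul, ← integral_sub (hint _) ((hint _).const_mul 2),
      ← integral_add hsub (hint _)]
    refine integral_congr_ae (ae_of_all _ fun x => ?_)
    simp only [Nat.add_sub_cancel]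
    ring
  rw [infl, hsplit, setIntegral_mul_oStat i (by omega), setIntegral_mul_oStat i (by omega),
    setIntegral_mul_oStat i (by omega)]
  push_cast
  field_simp
  ring
end

section
/- Let f(x) = (∏_{i=1}^n x_i)^c with c > −1/2, and define I(f,k) = −(n+1)(n+2) ∫_{[0,1]^n} f(x)·(x_{(k+1)} − 2x_{(k)} + x_{(k−1)}) dx (conventions x_{(0)}=0, x_{(n+1)}=1). Then I(f,k) = c · (1/(c+1))^{n+2} · Γ(n+3)·Γ(k−1+1/(c+1)) / (Γ(k+1)·Γ(n+1+1/(c+1))). -/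
open MeasureTheory Finset

/-- In a sorted list, `t ≤ l[j]` holds iff at most `j` entries lie below `t`. -/
theorem List.Pairwise.le_getD_iff_countP_lt {l : List ℝ} (h : l.Pairwise (· ≤ ·)) (t d : ℝ) {j : ℕ}
    (hj : j < l.length) : t ≤ l.getD j d ↔ l.countP (· < t) ≤ j := by
  induction l generalizing j with
  | nil => simp at hj
  | cons a l ih =>
    obtain ⟨ha, hl⟩ := List.pairwise_cons.1 h
    by_cases hat : a < t
    · cases j with
      | zero => simp [hat]
      | succ j =>
        have := ih hl (j := j) (by simpa using hj)
        simpa [hat] using this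
    · have h0 : l.countP (· < t) = 0 := by
        rw [List.countP_eq_zero]
        intro b hb
        have := ha b hb
        simp only [decide_eq_true_eq]
        linarith
      cases j with
      | zero => simp [hat, h0, not_lt.1 hat]
      | succ j =>
        have := ih hl (j := j) (by simpa using hj)
        simpa [hat, h0] using this

/-- On `(0, 1]`, the order statistic `oStat x k` is at least `t` iff fewer than `k` coordinates
lie below `t`. -/
theorem le_oStat_iff {n : ℕ} (x : Fin n → ℝ) {k : ℕ} (hk : k ≤ n + 1) {t : ℝ}
    (ht : t ∈ Set.Ioc (0 : ℝ) 1) : t ≤ oStat x k ↔ #{i | x i < t} < k := by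
  unfold oStat
  split_ifs with h0 h1
  · simp [h0, ht.1]
  · rw [(Multiset.pairwise_sort _ _).le_getD_iff_countP_lt _ _ (by simp; omega),
      ← Multiset.coe_countP, Multiset.sort_eq, Multiset.countP_map, ← Finset.filter_val,
      Finset.card_val]
    omega
  · have := (Finset.card_filter_le univ (fun i => x i < t))
    simp only [card_univ, Fintype.card_fin] at this
    simp only [ht.2, true_iff]
    omega

theorem oStat_mem_Icc {n : ℕ} {x : Fin n → ℝ} (hx : x ∈ Set.Icc (0 : Fin n → ℝ) 1) (k : ℕ) :
    oStat x k ∈ Set.Icc (0 : ℝ) 1 := by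
  unfold oStat
  split_ifs with h0 h1
  · simp
  · have hlen : k - 1 < ((Finset.univ.val.map x).sort (· ≤ ·)).length := by simp; omega
    rw [List.getD_eq_getElem _ _ hlen]
    obtain ⟨i, -, hi⟩ := Multiset.mem_map.1 ((Multiset.mem_sort _).1 (List.getElem_mem hlen))
    rw [← hi]
    exact ⟨hx.1 i, hx.2 i⟩
  · simp

/-- Layer-cake formula for the gap between two consecutive order statistics. -/
theorem oStat_succ_sub_oStat {n : ℕ} {x : Fin n → ℝ} (hx : x ∈ Set.Icc (0 : Fin n → ℝ) 1) {k : ℕ}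
    (hk : k ≤ n) : oStat x (k + 1) - oStat x k =
      ∫ t in Set.Ioc (0 : ℝ) 1, if #{i | x i < t} = k then (1 : ℝ) else 0 := by
  have h₁ := oStat_mem_Icc hx k
  have h₂ := oStat_mem_Icc hx (k + 1)
  have hle : oStat x k ≤ oStat x (k + 1) := by
    by_contra! hlt
    have ht : oStat x k ∈ Set.Ioc (0 : ℝ) 1 := ⟨h₂.1.trans_lt hlt, h₁.2⟩
    have := (le_oStat_iff x (by omega) ht).1 le_rfl
    exact hlt.not_ge ((le_oStat_iff x (k := k + 1) (by omega) ht).2 (by omega))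
  have hcongr : ∀ t ∈ Set.Ioc (0 : ℝ) 1, (if #{i | x i < t} = k then (1 : ℝ) else 0) =
      (Set.Ioc (oStat x k) (oStat x (k + 1))).indicator 1 t := by
    intro t ht
    have e₁ := le_oStat_iff x (k := k) (by omega) ht
    have e₂ := le_oStat_iff x (k := k + 1) (by omega) ht
    rw [Set.indicator_apply]
    simp only [Set.mem_Ioc, ← not_le, e₁, e₂, Pi.one_apply]
    refine if_congr ?_ rfl rfl
    omega
  rw [setIntegral_congr_fun measurableSet_Ioc hcongr, integral_indicator_one measurableSet_Ioc,
    measureReal_restrict_apply measurableSet_Ioc, Set.Ioc_inter_Ioc, max_eq_left h₁.1,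
    min_eq_left h₂.2, Real.volume_real_Ioc_of_le hle]

/-- Splitting the event that exactly `k` coordinates lie below `t` according to which ones do. -/
theorem ite_card_filter_lt_eq {n : ℕ} (x : Fin n → ℝ) (t : ℝ) (k : ℕ) :
    (if #{i | x i < t} = k then (1 : ℝ) else 0) = ∑ S ∈ powersetCard k univ,
      ∏ i, if (i ∈ S ↔ x i < t) then (1 : ℝ) else 0 := by
  have h (S : Finset (Fin n)) : (∏ i, if (i ∈ S ↔ x i < t) then (1 : ℝ) else 0) =
      if ({i | x i < t} : Finset (Fin n)) = S then 1 else 0 := by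
    rw [Finset.prod_ite_zero]
    simp [Finset.ext_iff, iff_comm]
  simp_rw [h, Finset.sum_ite_eq, mem_powersetCard]
  simp

/-- The Beta integral over the reals. -/
theorem integral_rpow_mul_one_sub_rpow {α β : ℝ} (hα : 0 < α) (hβ : 0 < β) :
    ∫ x in (0 : ℝ)..1, x ^ (α - 1) * (1 - x) ^ (β - 1) =
      Real.Gamma α * Real.Gamma β / Real.Gamma (α + β) := by
  have h := Complex.betaIntegral_eq_Gamma_mul_div α β (by simpa) (by simpa)
  rw [Complex.betaIntegral, ← Complex.ofReal_add, Complex.Gamma_ofReal, Complex.Gamma_ofReal,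
    Complex.Gamma_ofReal, ← Complex.ofReal_mul, ← Complex.ofReal_div] at h
  apply Complex.ofReal_injective
  rw [← h, ← intervalIntegral.integral_ofReal]
  refine intervalIntegral.integral_congr fun x hx => ?_
  rw [Set.uIcc_of_le zero_le_one] at hx
  simp [Complex.ofReal_cpow hx.1, Complex.ofReal_cpow (sub_nonneg.2 hx.2)]

theorem integrable_rpow_unitInterval {c : ℝ} (hc : -1 < c) :
    Integrable (fun x : ℝ => x ^ c) (volume.restrict (Set.Icc 0 1)) := by
  have := intervalIntegral.intervalIntegrable_rpow' hc (a := 0) (b := 1)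
  rwa [intervalIntegrable_iff_integrableOn_Icc_of_le zero_le_one] at this

theorem setIntegral_rpow_mul_ite {c : ℝ} (hc : -1 < c) {t : ℝ} (ht : t ∈ Set.Ioc (0 : ℝ) 1)
    (p : Prop) [Decidable p] :
    ∫ x in Set.Icc (0 : ℝ) 1, x ^ c * (if (p ↔ x < t) then (1 : ℝ) else 0) =
      (c + 1)⁻¹ * (if p then t ^ (c + 1) else 1 - t ^ (c + 1)) := by
  have hc' : c + 1 ≠ 0 := by linarith
  rw [integral_Icc_eq_integral_Ioc, ← intervalIntegral.integral_of_le zero_le_one]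
  by_cases hp : p
  · have hint : ∫ x in (0 : ℝ)..1, x ^ c * (if (p ↔ x < t) then (1 : ℝ) else 0) =
        ∫ x in (0 : ℝ)..t, x ^ c := by
      rw [intervalIntegral.integral_of_le zero_le_one, intervalIntegral.integral_of_le ht.1.le,
        integral_Ioc_eq_integral_Ioo (y := t), ← integral_indicator measurableSet_Ioc,
        ← integral_indicator measurableSet_Ioo]
      congr 1 with x
      have := ht.2
      by_cases hx : x < t
      · simp [Set.indicator_apply, hp, hx, (hx.trans_le this).le]
      · simp [Set.indicator_apply, hp, hx]
    rw [hint, integral_rpow (.inl hc), Real.zero_rpow hc']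
    simp [hp]
    ring
  · have hint : ∫ x in (0 : ℝ)..1, x ^ c * (if (p ↔ x < t) then (1 : ℝ) else 0) =
        ∫ x in t..1, x ^ c := by
      rw [intervalIntegral.integral_of_le zero_le_one, intervalIntegral.integral_of_le ht.2,
        ← integral_Icc_eq_integral_Ioc (x := t), ← integral_indicator measurableSet_Ioc,
        ← integral_indicator measurableSet_Icc]
      congr 1 with x
      have := ht.1
      by_cases hx : x < t
      · simp [Set.indicator_apply, hp, hx]
      · simp [Set.indicator_apply, hp, this.trans_le (not_lt.1 hx), not_lt.1 hx]
    rw [hint, integral_rpow (.inl hc), Real.one_rpow]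
    simp [hp]
    ring

/-- The substitution `t = u ^ (c + 1)⁻¹` turns this integral into a Beta integral. -/
theorem integral_rpow_pow_mul_one_sub_rpow_pow {c : ℝ} (hc : -1 < c) (k m : ℕ) :
    ∫ t in Set.Ioc (0 : ℝ) 1, (t ^ (c + 1)) ^ k * (1 - t ^ (c + 1)) ^ m =
      (c + 1)⁻¹ * (Real.Gamma (k + (c + 1)⁻¹) * m.factorial /
        Real.Gamma (k + m + 1 + (c + 1)⁻¹)) := by
  have hc' : 0 < c + 1 := by linarith
  have ha : 0 < (c + 1)⁻¹ := inv_pos.2 hc'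
  set a := (c + 1)⁻¹ with ha_def
  set g : ℝ → ℝ := (Set.Ioc (0 : ℝ) 1).indicator
    fun t => (t ^ (c + 1)) ^ k * (1 - t ^ (c + 1)) ^ m with hg
  have h₁ : ∫ t in Set.Ioc (0 : ℝ) 1, (t ^ (c + 1)) ^ k * (1 - t ^ (c + 1)) ^ m =
      ∫ t in Set.Ioi (0 : ℝ), g t := by
    rw [hg, setIntegral_indicator measurableSet_Ioc,
      Set.inter_eq_right.2 Set.Ioc_subset_Ioi_self]
  have h₂ : ∀ u ∈ Set.Ioi (0 : ℝ), (|a| * u ^ (a - 1)) • g (u ^ a) =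
      (Set.Ioc (0 : ℝ) 1).indicator
        (fun u => a * (u ^ (k + a - 1) * (1 - u) ^ ((m + 1 : ℝ) - 1))) u := by
    intro u (hu : 0 < u)
    have hmem : u ^ a ∈ Set.Ioc (0 : ℝ) 1 ↔ u ∈ Set.Ioc (0 : ℝ) 1 := by
      simp [hu, Real.rpow_pos_of_pos hu, Real.rpow_le_one_iff_of_pos hu, ha.not_ge, ha.le]
    have hinv : (u ^ a) ^ (c + 1) = u := Real.rpow_inv_rpow hu.le hc'.ne'
    have hpow : u ^ (k + a - 1) = u ^ (a - 1) * u ^ k := by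
      rw [← Real.rpow_natCast, ← Real.rpow_add hu]
      ring_nf
    simp only [hg, Set.indicator_apply, hmem, hinv, abs_of_pos ha, smul_eq_mul, hpow,
      add_sub_cancel_right, Real.rpow_natCast]
    split_ifs <;> ring
  rw [h₁, ← integral_comp_rpow_Ioi g ha.ne', setIntegral_congr_fun measurableSet_Ioi h₂,
    setIntegral_indicator measurableSet_Ioc, Set.inter_eq_right.2 Set.Ioc_subset_Ioi_self,
    integral_const_mul, ← intervalIntegral.integral_of_le zero_le_one,
    integral_rpow_mul_one_sub_rpow (by positivity) (by positivity), Real.Gamma_nat_eq_factorial]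
  ring_nf

theorem restrict_Icc_zero_one_eq_pi (n : ℕ) :
    (volume : Measure (Fin n → ℝ)).restrict (Set.Icc 0 1) =
      Measure.pi fun _ => volume.restrict (Set.Icc (0 : ℝ) 1) := by
  rw [← Measure.restrict_pi_pi, volume_pi, ← Set.pi_univ_Icc]
  rfl

theorem integrable_prod_rpow_mul_ite {n : ℕ} {c : ℝ} (hc : -1 < c) (S : Finset (Fin n)) :
    Integrable (fun p : (Fin n → ℝ) × ℝ =>
        ∏ i, p.1 i ^ c * (if (i ∈ S ↔ p.1 i < p.2) then (1 : ℝ) else 0))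
      ((volume.restrict (Set.Icc 0 1)).prod (volume.restrict (Set.Ioc (0 : ℝ) 1))) := by
  rw [restrict_Icc_zero_one_eq_pi]
  have hprod : Integrable (fun x : Fin n → ℝ => ∏ i, x i ^ c)
      (Measure.pi fun _ => volume.restrict (Set.Icc (0 : ℝ) 1)) :=
    Integrable.fintype_prod fun _ => integrable_rpow_unitInterval hc
  refine (hprod.comp_fst _).mono ?_ (.of_forall fun p => ?_)
  · refine Measurable.aestronglyMeasurable (Finset.measurable_fun_prod _ fun i _ => ?_)
    have hlt : MeasurableSet {p : (Fin n → ℝ) × ℝ | p.1 i < p.2} :=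
      measurableSet_lt (by fun_prop) (by fun_prop)
    refine Measurable.mul (by fun_prop) (Measurable.ite ?_ measurable_const measurable_const)
    by_cases hi : i ∈ S
    · simpa [hi] using hlt
    · simp only [hi, false_iff]
      exact hlt.compl
  · rw [norm_prod, norm_prod]
    refine Finset.prod_le_prod (fun _ _ => norm_nonneg _) fun i _ => ?_
    rw [norm_mul]
    refine mul_le_of_le_one_right (norm_nonneg _) ?_
    split_ifs <;> simp

theorem setIntegral_prod_rpow_mul_ite {n : ℕ} {c : ℝ} (hc : -1 < c) {t : ℝ}
    (ht : t ∈ Set.Ioc (0 : ℝ) 1) (S : Finset (Fin n)) :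
    ∫ x in Set.Icc (0 : Fin n → ℝ) 1,
        ∏ i, x i ^ c * (if (i ∈ S ↔ x i < t) then (1 : ℝ) else 0) =
      ((c + 1)⁻¹) ^ n * ((t ^ (c + 1)) ^ #S * (1 - t ^ (c + 1)) ^ (n - #S)) := by
  rw [restrict_Icc_zero_one_eq_pi, integral_fintype_prod_eq_prod
    (fun i y => y ^ c * (if (i ∈ S ↔ y < t) then (1 : ℝ) else 0))]
  simp_rw [setIntegral_rpow_mul_ite hc ht]
  rw [Finset.prod_mul_distrib, Finset.prod_ite]
  simp [Finset.filter_not, Finset.card_sdiff]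

theorem integrableOn_prod_rpow_mul_oStat_gap {n : ℕ} {c : ℝ} (hc : -1 < c) {k : ℕ} (hk : k ≤ n) :
    IntegrableOn (fun x : Fin n → ℝ => (∏ i, x i) ^ c * (oStat x (k + 1) - oStat x k))
        (Set.Icc 0 1) ∧
      ∫ x in Set.Icc (0 : Fin n → ℝ) 1, (∏ i, x i) ^ c * (oStat x (k + 1) - oStat x k) =
        ((c + 1)⁻¹) ^ (n + 1) * n.factorial / k.factorial *
          (Real.Gamma (k + (c + 1)⁻¹) / Real.Gamma (n + 1 + (c + 1)⁻¹)) := by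
  have hcongr : ∀ x ∈ Set.Icc (0 : Fin n → ℝ) 1,
      (∏ i, x i) ^ c * (oStat x (k + 1) - oStat x k) =
        ∫ t in Set.Ioc (0 : ℝ) 1, ∑ S ∈ powersetCard k univ,
          ∏ i, x i ^ c * (if (i ∈ S ↔ x i < t) then (1 : ℝ) else 0) := by
    intro x hx
    simp_rw [oStat_succ_sub_oStat hx hk, ← integral_const_mul, ite_card_filter_lt_eq,
      ← Real.finsetProd_rpow _ _ fun i _ => hx.1 i, Finset.mul_sum, ← Finset.prod_mul_distrib]
  have hint := integrable_finsetSum (powersetCard k (univ : Finset (Fin n)))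
    fun S _ => integrable_prod_rpow_mul_ite hc S
  refine ⟨(integrableOn_congr_fun hcongr measurableSet_Icc).2 hint.integral_prod_left, ?_⟩
  rw [setIntegral_congr_fun measurableSet_Icc hcongr, integral_integral_swap hint]
  have hinner : ∀ t ∈ Set.Ioc (0 : ℝ) 1, ∫ x in Set.Icc (0 : Fin n → ℝ) 1,
      ∑ S ∈ powersetCard k univ, ∏ i, x i ^ c * (if (i ∈ S ↔ x i < t) then (1 : ℝ) else 0) =
      (n.choose k * ((c + 1)⁻¹) ^ n) * ((t ^ (c + 1)) ^ k * (1 - t ^ (c + 1)) ^ (n - k)) := by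
    intro t ht
    rw [integral_finsetSum]
    · rw [Finset.sum_congr rfl fun S hS => by
        rw [setIntegral_prod_rpow_mul_ite hc ht, (mem_powersetCard.1 hS).2]]
      simp [mul_assoc]
    · intro S _
      rw [restrict_Icc_zero_one_eq_pi]
      refine Integrable.fintype_prod
        (f := fun i y => y ^ c * (if (i ∈ S ↔ y < t) then (1 : ℝ) else 0)) fun i => ?_
      refine (integrable_rpow_unitInterval hc).mul_bdd (c := 1) ?_ (.of_forall fun y => ?_)
      · refine Measurable.aestronglyMeasurable
          (Measurable.ite ?_ measurable_const measurable_const)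
        by_cases hi : i ∈ S
        · simp only [hi, true_iff]
          exact measurableSet_Iio
        · simp only [hi, false_iff, not_lt]
          exact measurableSet_Ici
      · split_ifs <;> simp
  rw [setIntegral_congr_fun measurableSet_Ioc hinner, integral_const_mul,
    integral_rpow_pow_mul_one_sub_rpow_pow hc, Nat.cast_choose ℝ hk, Nat.cast_sub hk]
  have := (n - k).factorial_ne_zero
  rw [add_sub_cancel]
  generalize (c + 1)⁻¹ = a
  field_simp
  ring

theorem stmt14 (n : ℕ) (c : ℝ) (hc : -(1/2) < c) (k : ℕ) (hk : 1 ≤ k) (hkn : k ≤ n) :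
    infl (fun x : Fin n → ℝ => (∏ i, x i) ^ c) k =
      c * (1 / (c + 1)) ^ (n + 2) *
        (Real.Gamma ((n : ℝ) + 3) * Real.Gamma ((k : ℝ) - 1 + 1 / (c + 1))) /
        (Real.Gamma ((k : ℝ) + 1) * Real.Gamma ((n : ℝ) + 1 + 1 / (c + 1))) := by
  obtain ⟨k, rfl⟩ := Nat.exists_eq_add_of_le' hk
  have hc' : 0 < c + 1 := by linarith
  have ha : 0 < (c + 1)⁻¹ := inv_pos.2 hc'
  obtain ⟨hi₁, he₁⟩ := integrableOn_prod_rpow_mul_oStat_gap (c := c) (by linarith) hkn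
  obtain ⟨hi₀, he₀⟩ :=
    integrableOn_prod_rpow_mul_oStat_gap (c := c) (by linarith) (Nat.le_of_succ_le hkn)
  have hsplit (x : Fin n → ℝ) :
      (∏ i, x i) ^ c * (oStat x (k + 1 + 1) - 2 * oStat x (k + 1) + oStat x (k + 1 - 1)) =
        (∏ i, x i) ^ c * (oStat x (k + 1 + 1) - oStat x (k + 1)) -
          (∏ i, x i) ^ c * (oStat x (k + 1) - oStat x k) := by
    rw [Nat.add_sub_cancel]
    ring
  have hG : Real.Gamma ((n : ℝ) + 3) = (n + 2) * ((n + 1) * n.factorial) := by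
    rw [show (n : ℝ) + 3 = ((n + 2 : ℕ) : ℝ) + 1 by push_cast; ring, Real.Gamma_nat_eq_factorial,
      Nat.factorial_succ, Nat.factorial_succ]
    push_cast
    ring
  have hG' : Real.Gamma (k + 1 + (c + 1)⁻¹) = (k + (c + 1)⁻¹) * Real.Gamma (k + (c + 1)⁻¹) := by
    rw [← Real.Gamma_add_one (by positivity)]
    ring_nf
  have hΓ : Real.Gamma (n + 1 + (c + 1)⁻¹) ≠ 0 := (Real.Gamma_pos_of_pos (by positivity)).ne'
  simp only [infl, hsplit]
  rw [integral_sub hi₁ hi₀, he₁, he₀, hG, Real.Gamma_nat_eq_factorial, one_div,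
    Nat.factorial_succ]
  push_cast
  rw [add_sub_cancel_right, hG']
  generalize Real.Gamma (k + (c + 1)⁻¹) = G₁ at *
  generalize Real.Gamma (n + 1 + (c + 1)⁻¹) = G₂ at *
  have hk₁ : (k : ℝ) + 1 ≠ 0 := by positivity
  have hk₀ : (k.factorial : ℝ) ≠ 0 := by positivity
  have hca : c = ((c + 1)⁻¹)⁻¹ - 1 := by rw [inv_inv, add_sub_cancel_right]
  generalize (c + 1)⁻¹ = a at *
  subst hca
  field_simp
  ring
end

section
/- For every nonempty S ⊆ {1,...,n}, every j ∈ {1,...,|S|}, and every k ∈ {1,...,n}: define I(f,k) = −(n+1)(n+2) ∫_{[0,1]^n} f(x)·(x_{(k+1)} − 2x_{(k)} + x_{(k−1)}) dx (conventions x_{(0)}=0, x_{(n+1)}=1). Then I(os_{j:S}, k) = binom(k−1, j−1)·binom(n−k, |S|−j) / binom(n, |S|) if 0 ≤ k−j ≤ n−|S|, and I(os_{j:S}, k) = 0 otherwise, where os_{j:S}(x) is the j-th smallest among the coordinates x_i, i ∈ S. -/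
open MeasureTheory Finset

theorem getD_sort_map_of_monotone {s : ℕ} {f : Fin s → ℝ} (hf : Monotone f) (i : Fin s) :
    ((Finset.univ.val.map f).sort (· ≤ ·)).getD i 0 = f i := by
  have h : (Finset.univ.val.map f).sort (· ≤ ·) = List.ofFn f := by
    apply List.Perm.eq_of_pairwise' (r := (· ≤ ·)) (Multiset.pairwise_sort _ _)
      hf.sortedLE_ofFn.pairwise
    rw [← Multiset.coe_eq_coe, Multiset.sort_eq, Fin.univ_val_map]
  rw [h, List.getD_eq_getElem _ _ (by simp)]
  simp

theorem oStatS_orderEmbOfFin {n : ℕ} {y : Fin n → ℝ} (hy : Monotone y) (T : Finset (Fin n))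
    (i : Fin T.card) : oStatS T y (i + 1) = y (T.orderEmbOfFin rfl i) := by
  have h : T.val.map y = Finset.univ.val.map (y ∘ T.orderEmbOfFin rfl) := by
    conv_lhs => rw [← T.map_orderEmbOfFin_univ rfl, Finset.map_val, Multiset.map_map]
    rfl
  simpa [oStatS, h] using
    getD_sort_map_of_monotone (hy.comp (T.orderEmbOfFin rfl).monotone) i

theorem exists_orderEmbOfFin_eq {n : ℕ} {T : Finset (Fin n)} {a : Fin n} (ha : a ∈ T) :
    ∃ i, T.orderEmbOfFin rfl i = a := by
  rwa [← Finset.mem_coe, ← T.range_orderEmbOfFin rfl] at ha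

theorem card_filter_lt_orderEmbOfFin {n : ℕ} (T : Finset (Fin n)) (i : Fin T.card) :
    #{a ∈ T | a < T.orderEmbOfFin rfl i} = (i : ℕ) := by
  have h : {a ∈ T | a < T.orderEmbOfFin rfl i} =
      (Finset.Iio i).map (T.orderEmbOfFin rfl).toEmbedding := by
    ext a
    simp only [Finset.mem_filter, Finset.mem_map, Finset.mem_Iio]
    constructor
    · rintro ⟨ha, hb⟩
      obtain ⟨b, rfl⟩ := exists_orderEmbOfFin_eq ha
      exact ⟨b, by simpa using hb, rfl⟩
    · rintro ⟨b, hb, rfl⟩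
      exact ⟨T.orderEmbOfFin_mem rfl b, by simpa using hb⟩
  rw [h, Finset.card_map, Fin.card_Iio]

theorem oStatS_eq_sum {n : ℕ} {y : Fin n → ℝ} (hy : Monotone y) (T : Finset (Fin n)) {j : ℕ}
    (hj : 1 ≤ j) (hjT : j ≤ T.card) :
    oStatS T y j = ∑ m, if m ∈ T ∧ #{a ∈ T | a < m} = j - 1 then y m else 0 := by
  obtain ⟨j, rfl⟩ : ∃ i, j = i + 1 := ⟨j - 1, by omega⟩
  have h := oStatS_orderEmbOfFin hy T ⟨j, by omega⟩
  simp only at h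
  rw [h, Finset.sum_eq_single (T.orderEmbOfFin rfl ⟨j, by omega⟩)]
  · rw [if_pos]
    exact ⟨T.orderEmbOfFin_mem rfl _, by rw [card_filter_lt_orderEmbOfFin]; simp⟩
  · intro m _ hm
    rw [if_neg]
    rintro ⟨hmT, hc⟩
    obtain ⟨i, rfl⟩ := exists_orderEmbOfFin_eq hmT
    rw [card_filter_lt_orderEmbOfFin] at hc
    exact hm (congrArg _ (Fin.ext (by simpa using hc)))
  · simp

theorem oStatS_map {n : ℕ} (σ : Equiv.Perm (Fin n)) (T : Finset (Fin n)) (x : Fin n → ℝ) (j : ℕ) :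
    oStatS (T.map σ.toEmbedding) x j = oStatS T (x ∘ σ) j := by
  simp [oStatS, Finset.map_val, Multiset.map_map]

theorem card_filter_powersetCard_rank {n s j : ℕ} (hj : 1 ≤ j) (hjs : j ≤ s) (m : Fin n) :
    #{T ∈ powersetCard s (univ : Finset (Fin n)) | m ∈ T ∧ #{a ∈ T | a < m} = j - 1} =
      (m : ℕ).choose (j - 1) * (n - 1 - m).choose (s - j) := by
  have h : #(powersetCard (j - 1) (Iio m) ×ˢ powersetCard (s - j) (Ioi m)) =
      (m : ℕ).choose (j - 1) * (n - 1 - m).choose (s - j) := by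
    simp [Fin.card_Iio, Fin.card_Ioi]
  rw [← h]
  have key : ∀ T : Finset (Fin n), m ∈ T →
      #T = #{a ∈ T | a < m} + #{a ∈ T | m < a} + 1 := by
    intro T hm
    have e : T = insert m ({a ∈ T | a < m} ∪ {a ∈ T | m < a}) := by
      ext a
      rcases lt_trichotomy a m with h | h | h
      · simp [h, h.ne, h.not_gt]
      · simp [h, hm]
      · simp [h, h.ne', h.not_gt]
    conv_lhs => rw [e]
    rw [Finset.card_insert_of_notMem (by simp), Finset.card_union_of_disjoint]
    rw [Finset.disjoint_left]
    intro a ha hb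
    simp only [Finset.mem_filter] at ha hb
    exact lt_asymm ha.2 hb.2
  refine Finset.card_nbij' (fun T => ({a ∈ T | a < m}, {a ∈ T | m < a}))
    (fun p => insert m (p.1 ∪ p.2)) ?_ ?_ ?_ ?_
  · intro T hT
    simp only [Finset.coe_filter, Set.mem_ofPred_eq, mem_powersetCard] at hT
    have := key T hT.2.1
    simp only [Finset.mem_coe, Finset.mem_product, mem_powersetCard]
    refine ⟨⟨fun a => by simp, hT.2.2⟩, fun a => by simp, by omega⟩
  · rintro ⟨A, B⟩ hp
    simp only [Finset.mem_coe, Finset.mem_product, mem_powersetCard] at hp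
    obtain ⟨⟨hA, hA'⟩, hB, hB'⟩ := hp
    have hA2 : ∀ a ∈ A, a < m := fun a ha => by simpa using hA ha
    have hB2 : ∀ a ∈ B, m < a := fun a ha => by simpa using hB ha
    have e1 : {a ∈ insert m (A ∪ B) | a < m} = A := by ext a; grind
    have e2 : {a ∈ insert m (A ∪ B) | m < a} = B := by ext a; grind
    have := key (insert m (A ∪ B)) (by simp)
    rw [e1, e2] at this
    simp only [Finset.coe_filter, Set.mem_ofPred_eq, mem_powersetCard]
    refine ⟨⟨Finset.subset_univ _, by omega⟩, by simp, by rw [e1, hA']⟩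
  · intro T hT
    simp only [Finset.coe_filter, Set.mem_ofPred_eq, mem_powersetCard] at hT
    ext a
    grind
  · rintro ⟨A, B⟩ hp
    simp only [Finset.mem_coe, Finset.mem_product, mem_powersetCard] at hp
    obtain ⟨⟨hA, hA'⟩, hB, hB'⟩ := hp
    have hA2 : ∀ a ∈ A, a < m := fun a ha => by simpa using hA ha
    have hB2 : ∀ a ∈ B, m < a := fun a ha => by simpa using hB ha
    ext a <;> grind

theorem oStat_of_monotone {n : ℕ} {y : Fin n → ℝ} (hy : Monotone y) (i : Fin n) :
    oStat y (i + 1) = y i := by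
  have : (i : ℕ) + 1 ≤ n := i.2
  simpa [oStat, this] using getD_sort_map_of_monotone hy i

theorem oStat_congr {n : ℕ} {x y : Fin n → ℝ} (h : univ.val.map x = univ.val.map y) (k : ℕ) :
    oStat x k = oStat y k := by
  simp [oStat, h]

theorem map_univ_comp_perm {n : ℕ} (x : Fin n → ℝ) (σ : Equiv.Perm (Fin n)) :
    univ.val.map (x ∘ σ) = univ.val.map x := by
  conv_rhs => rw [← Finset.map_univ_equiv σ, Finset.map_val, Multiset.map_map]
  rfl

theorem sum_oStatS {n s j : ℕ} (hj : 1 ≤ j) (hjs : j ≤ s) (x : Fin n → ℝ) :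
    ∑ T ∈ powersetCard s (univ : Finset (Fin n)), oStatS T x j =
      ∑ m : Fin n, (((m : ℕ).choose (j - 1) * (n - 1 - m).choose (s - j) : ℕ) : ℝ) *
        oStat x (m + 1) := by
  set σ := Tuple.sort x
  have hσ : Monotone (x ∘ σ) := Tuple.monotone_sort x
  have h1 : ∑ T ∈ powersetCard s (univ : Finset (Fin n)), oStatS T x j =
      ∑ T ∈ powersetCard s (univ : Finset (Fin n)), oStatS T (x ∘ σ) j := by
    symm
    refine Finset.sum_equiv σ.finsetCongr ?_ ?_
    · intro T; simp
    · intro T _; rw [Equiv.finsetCongr_apply, oStatS_map]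
  rw [h1]
  have h2 : ∀ T ∈ powersetCard s (univ : Finset (Fin n)), oStatS T (x ∘ σ) j =
      ∑ m, if m ∈ T ∧ #{a ∈ T | a < m} = j - 1 then (x ∘ σ) m else 0 := fun T hT =>
    oStatS_eq_sum hσ T hj (by rw [(mem_powersetCard.1 hT).2]; exact hjs)
  rw [Finset.sum_congr rfl h2, Finset.sum_comm]
  refine Finset.sum_congr rfl fun m _ => ?_
  rw [← Finset.sum_filter, Finset.sum_const, card_filter_powersetCard_rank hj hjs, nsmul_eq_mul,
    ← oStat_of_monotone hσ, oStat_congr (map_univ_comp_perm x σ)]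

theorem continuous_oStatS {n : ℕ} (S : Finset (Fin n)) {j : ℕ} (hj : 1 ≤ j) (hjS : j ≤ #S) :
    Continuous fun x => oStatS S x j := by
  refine LocallyFinite.continuous (f := fun σ : Equiv.Perm (Fin n) => {x | Monotone (x ∘ σ)})
    (locallyFinite_of_finite _) ?_ ?_ ?_
  · exact Set.eq_univ_of_forall fun x => Set.mem_iUnion.2 ⟨_, Tuple.monotone_sort x⟩
  · intro σ
    simp only [Monotone, Set.ofPred_forall]
    refine isClosed_iInter fun a => isClosed_iInter fun b => isClosed_iInter fun _ => ?_
    exact isClosed_le (continuous_apply _) (continuous_apply _)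
  · intro σ
    have h : ∀ x ∈ {x : Fin n → ℝ | Monotone (x ∘ σ)}, oStatS S x j =
        ∑ m, if m ∈ S.map σ.symm.toEmbedding ∧
          #{a ∈ S.map σ.symm.toEmbedding | a < m} = j - 1 then (x ∘ σ) m else 0 := by
      intro x hx
      rw [← oStatS_eq_sum hx _ hj (by simpa using hjS), ← oStatS_map, Finset.map_map]
      congr 1
      ext a
      simp
    refine ContinuousOn.congr (Continuous.continuousOn ?_) h
    refine continuous_finsetSum _ fun m _ => ?_
    split_ifs
    · exact continuous_apply _
    · exact continuous_const

theorem oStat_eq_oStatS {n k : ℕ} (hk : 1 ≤ k) (hkn : k ≤ n) (x : Fin n → ℝ) :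
    oStat x k = oStatS univ x k := by
  simp [oStat, oStatS, hkn, Nat.one_le_iff_ne_zero.1 hk]

theorem continuous_oStat {n : ℕ} (k : ℕ) : Continuous fun x : Fin n → ℝ => oStat x k := by
  by_cases h0 : k = 0
  · simpa [oStat, h0] using continuous_const
  by_cases hn : k ≤ n
  · simpa only [oStat_eq_oStatS (Nat.one_le_iff_ne_zero.2 h0) hn] using
      continuous_oStatS univ (Nat.one_le_iff_ne_zero.2 h0) (by simpa using hn)
  · simpa [oStat, h0, hn] using continuous_const

theorem oStat_succ_self {n : ℕ} (x : Fin n → ℝ) : oStat x (n + 1) = 1 := by simp [oStat]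

/-- The uniform distribution on the unit cube. -/
noncomputable def cubeMeasure (n : ℕ) : Measure (Fin n → ℝ) :=
  Measure.pi fun _ => volume.restrict (Set.Icc (0 : ℝ) 1)

theorem isProbabilityMeasure_restrict_Icc :
    IsProbabilityMeasure (volume.restrict (Set.Icc (0 : ℝ) 1)) :=
  ⟨by simp⟩

theorem isProbabilityMeasure_cubeMeasure (n : ℕ) : IsProbabilityMeasure (cubeMeasure n) := by
  have := isProbabilityMeasure_restrict_Icc
  unfold cubeMeasure
  infer_instance

theorem restrict_Icc_eq_cubeMeasure (n : ℕ) :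
    volume.restrict (Set.Icc (0 : Fin n → ℝ) 1) = cubeMeasure n := by
  rw [cubeMeasure, ← Measure.restrict_pi_pi, ← Set.pi_univ_Icc]
  rfl

theorem integrable_cubeMeasure {n : ℕ} {f : (Fin n → ℝ) → ℝ} (hf : Continuous f) :
    Integrable f (cubeMeasure n) := by
  rw [← restrict_Icc_eq_cubeMeasure]
  exact hf.continuousOn.integrableOn_compact isCompact_Icc

theorem ae_mem_Icc_cubeMeasure (n : ℕ) :
    ∀ᵐ y ∂cubeMeasure n, y ∈ Set.Icc (0 : Fin n → ℝ) 1 := by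
  rw [← restrict_Icc_eq_cubeMeasure]
  exact ae_restrict_mem measurableSet_Icc

theorem ae_ne_zero_of_linearMap {n : ℕ} {L : (Fin n → ℝ) →ₗ[ℝ] ℝ} (hL : L ≠ 0) :
    ∀ᵐ y ∂cubeMeasure n, L y ≠ 0 := by
  rw [← restrict_Icc_eq_cubeMeasure]
  apply ae_restrict_of_ae
  have := Measure.addHaar_submodule (volume : Measure (Fin n → ℝ)) (LinearMap.ker L)
    (fun h => hL (LinearMap.ker_eq_top.1 h))
  rw [ae_iff]
  convert this using 2
  ext y
  simp

theorem ae_injective_cubeMeasure (n : ℕ) :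
    ∀ᵐ y ∂cubeMeasure n, Function.Injective y := by
  have h : ∀ᵐ y ∂cubeMeasure n, ∀ i j : Fin n, i ≠ j → y i - y j ≠ 0 := by
    rw [ae_all_iff]; intro i
    rw [ae_all_iff]; intro j
    refine Filter.eventually_imp_distrib_left.2 fun hij => ?_
    refine ae_ne_zero_of_linearMap
      (L := LinearMap.proj (R := ℝ) (φ := fun _ : Fin n => ℝ) i - LinearMap.proj j) ?_
    intro h
    have := LinearMap.congr_fun h (Pi.single i 1)
    simp [hij.symm] at this
  filter_upwards [h] with y hy i j hij
  by_contra hne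
  exact hy i j hne (sub_eq_zero.2 hij)

theorem ae_pos_cubeMeasure (n : ℕ) : ∀ᵐ y ∂cubeMeasure n, ∀ i, 0 < y i := by
  have h : ∀ᵐ y ∂cubeMeasure n, ∀ i : Fin n, y i ≠ 0 := by
    rw [ae_all_iff]; intro i
    refine ae_ne_zero_of_linearMap (L := LinearMap.proj (R := ℝ) (φ := fun _ : Fin n => ℝ) i) ?_
    intro h
    have := LinearMap.congr_fun h (Pi.single i 1)
    simp at this
  filter_upwards [h, ae_mem_Icc_cubeMeasure n] with y hy hI i
  exact lt_of_le_of_ne (hI.1 i) (hy i).symm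

theorem oStat_le_oStat_succ {n : ℕ} {x : Fin n → ℝ} (hx : x ∈ Set.Icc (0 : Fin n → ℝ) 1) (k : ℕ) :
    oStat x k ≤ oStat x (k + 1) := by
  rcases k with _ | k
  · simpa [oStat_zero] using (oStat_mem_Icc hx 1).1
  · by_cases hk : k + 1 < n
    · rw [← oStat_congr (map_univ_comp_perm x (Tuple.sort x)),
        ← oStat_congr (map_univ_comp_perm x (Tuple.sort x)),
        oStat_of_monotone (Tuple.monotone_sort x) ⟨k, by omega⟩,
        oStat_of_monotone (Tuple.monotone_sort x) ⟨k + 1, hk⟩]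
      exact Tuple.monotone_sort x (by simp)
    · have : oStat x (k + 1 + 1) = 1 := by simp [oStat, show ¬ k + 1 + 1 ≤ n by omega]
      rw [this]
      exact (oStat_mem_Icc hx _).2

theorem mem_gap_iff {n : ℕ} {z : Fin (n + 1) → ℝ} (hz : StrictMono z) (hpos : ∀ i, 0 < z i)
    (hle : ∀ i, z i ≤ 1) (p q : Fin (n + 1)) :
    (oStat (z ∘ q.succAbove) p < z q ∧ z q ≤ oStat (z ∘ q.succAbove) (p + 1)) ↔ q = p := by
  have hmono : Monotone (z ∘ q.succAbove) := (hz.comp q.strictMono_succAbove).monotone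
  have h1 : oStat (z ∘ q.succAbove) p < z q ↔ p ≤ q := by
    induction p using Fin.cases with
    | zero => simp [oStat_zero, hpos]
    | succ p =>
      rw [Fin.val_succ, oStat_of_monotone hmono p, Function.comp_apply, hz.lt_iff_lt,
        Fin.succAbove_lt_iff_succ_le]
  have h2 : z q ≤ oStat (z ∘ q.succAbove) (p + 1) ↔ q ≤ p := by
    induction p using Fin.lastCases with
    | last => simp [oStat_succ_self, hle, Fin.le_last]
    | cast p =>
      rw [Fin.val_castSucc, oStat_of_monotone hmono p, Function.comp_apply, hz.le_iff_le,
        ← Fin.lt_succAbove_iff_le_castSucc]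
      exact ⟨fun h => lt_of_le_of_ne h (Fin.succAbove_ne q p).symm, le_of_lt⟩
  rw [h1, h2]
  exact ⟨fun h => le_antisymm h.2 h.1, fun h => ⟨h.ge, h.le⟩⟩

/-- Summing over the coordinate that is taken out, only the coordinate of rank `p` falls into the
`p`-th gap of the others. -/
theorem sum_removeNth_gap {n : ℕ} {G : (Fin n → ℝ) → ℝ}
    (hG : ∀ x x' : Fin n → ℝ, univ.val.map x = univ.val.map x' → G x = G x') (p : Fin (n + 1))
    {y : Fin (n + 1) → ℝ} (hy : Function.Injective y) (hpos : ∀ i, 0 < y i) (hle : ∀ i, y i ≤ 1) :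
    ∑ i, (if oStat (i.removeNth y) p < y i ∧ y i ≤ oStat (i.removeNth y) (p + 1) then
      G (i.removeNth y) else 0) = G fun i => oStat y (p.succAbove i + 1) := by
  set σ := Tuple.sort y
  set z := y ∘ σ with hz
  have hmono : Monotone z := Tuple.monotone_sort y
  have hstrict : StrictMono z := hmono.strictMono_of_injective (hy.comp σ.injective)
  have hrem : ∀ q, univ.val.map ((σ q).removeNth y) = univ.val.map (z ∘ q.succAbove) := by
    intro q
    have h := map_univ_comp_perm y σ
    rw [← hz] at h
    have e : ∀ (w : Fin (n + 1) → ℝ) (r : Fin (n + 1)),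
        univ.val.map w = w r ::ₘ univ.val.map (w ∘ r.succAbove) := by
      intro w r
      rw [Fin.univ_succAbove n r, Finset.cons_val, Multiset.map_cons, Finset.map_val,
        Multiset.map_map]
      rfl
    rw [e z q, e y (σ q)] at h
    exact ((Multiset.cons_inj_right _).1 h).symm
  rw [← Equiv.sum_comp σ]
  have hterm : ∀ q, (if oStat ((σ q).removeNth y) p < y (σ q) ∧
      y (σ q) ≤ oStat ((σ q).removeNth y) (p + 1) then G ((σ q).removeNth y) else 0) =
      if q = p then G (z ∘ q.succAbove) else 0 := by
    intro q
    rw [oStat_congr (hrem q), oStat_congr (hrem q), hG _ _ (hrem q)]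
    exact if_congr (mem_gap_iff hstrict (fun i => hpos _) (fun i => hle _) p q) rfl rfl
  simp only [hterm, Finset.sum_ite_eq', Finset.mem_univ, if_true]
  congr 1
  ext i
  rw [← oStat_congr (map_univ_comp_perm y σ), oStat_of_monotone hmono]
  rfl

theorem integral_gap {n : ℕ} {G : (Fin n → ℝ) → ℝ} (hGc : Continuous G)
    (hG : ∀ x x' : Fin n → ℝ, univ.val.map x = univ.val.map x' → G x = G x') (p : Fin (n + 1)) :
    ((n : ℝ) + 1) * ∫ x, G x * (oStat x (p + 1) - oStat x p) ∂cubeMeasure n =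
      ∫ y, G (fun i => oStat y (p.succAbove i + 1)) ∂cubeMeasure (n + 1) := by
  have := isProbabilityMeasure_restrict_Icc
  have := isProbabilityMeasure_cubeMeasure n
  set ν := volume.restrict (Set.Icc (0 : ℝ) 1)
  set A : Set (ℝ × (Fin n → ℝ)) := {w | oStat w.2 p < w.1 ∧ w.1 ≤ oStat w.2 (p + 1)} with hA
  have hAm : MeasurableSet A :=
    (measurableSet_lt ((continuous_oStat _).comp continuous_snd).measurable measurable_fst).inter
      (measurableSet_le measurable_fst ((continuous_oStat _).comp continuous_snd).measurable)
  set h : ℝ × (Fin n → ℝ) → ℝ := A.indicator fun w => G w.2 with hh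
  have hint : Integrable h (ν.prod (cubeMeasure n)) :=
    ((integrable_cubeMeasure hGc).comp_snd ν).indicator hAm
  have hfub : ∫ w, h w ∂ν.prod (cubeMeasure n) =
      ∫ x, G x * (oStat x (p + 1) - oStat x p) ∂cubeMeasure n := by
    rw [integral_prod_symm _ hint]
    refine integral_congr_ae ?_
    filter_upwards [ae_mem_Icc_cubeMeasure n] with x hx
    have e : (fun v => h (v, x)) =
        (Set.Ioc (oStat x p) (oStat x (p + 1))).indicator fun _ => G x := by
      ext v
      simp [hh, hA, Set.indicator_apply]
    have hsub : Set.Ioc (oStat x p) (oStat x (p + 1)) ⊆ Set.Icc 0 1 := fun v hv =>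
      ⟨(oStat_mem_Icc hx _).1.trans hv.1.le, hv.2.trans (oStat_mem_Icc hx _).2⟩
    rw [e, integral_indicator measurableSet_Ioc, setIntegral_const,
      measureReal_restrict_apply measurableSet_Ioc, Set.inter_eq_left.2 hsub,
      Real.volume_real_Ioc_of_le (oStat_le_oStat_succ hx _), smul_eq_mul, mul_comm]
  have hpres : ∀ i : Fin (n + 1), MeasurePreserving
      (MeasurableEquiv.piFinSuccAbove (fun _ : Fin (n + 1) => ℝ) i) (cubeMeasure (n + 1))
      (ν.prod (cubeMeasure n)) := fun i => measurePreserving_piFinSuccAbove (fun _ => ν) i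
  have hi : ∀ i : Fin (n + 1), ∫ y, h (y i, i.removeNth y) ∂cubeMeasure (n + 1) =
      ∫ w, h w ∂ν.prod (cubeMeasure n) := fun i =>
    (hpres i).integral_comp (MeasurableEquiv.measurableEmbedding _) h
  have hii : ∀ i : Fin (n + 1), Integrable (fun y => h (y i, i.removeNth y)) (cubeMeasure (n + 1)) :=
    fun i => ((hpres i).integrable_comp_emb (MeasurableEquiv.measurableEmbedding _)).2 hint
  calc ((n : ℝ) + 1) * ∫ x, G x * (oStat x (p + 1) - oStat x p) ∂cubeMeasure n
      = ∑ i : Fin (n + 1), ∫ y, h (y i, i.removeNth y) ∂cubeMeasure (n + 1) := by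
        simp [hi, hfub]
    _ = ∫ y, ∑ i : Fin (n + 1), h (y i, i.removeNth y) ∂cubeMeasure (n + 1) :=
        (integral_finsetSum _ fun i _ => hii i).symm
    _ = _ := by
        refine integral_congr_ae ?_
        filter_upwards [ae_mem_Icc_cubeMeasure (n + 1), ae_injective_cubeMeasure (n + 1),
          ae_pos_cubeMeasure (n + 1)] with y hI hinj hpos
        rw [← sum_removeNth_gap hG p hinj hpos hI.2]
        simp [hh, hA, Set.indicator_apply]

theorem integral_oStat_gap (n : ℕ) (p : Fin (n + 1)) :
    ((n : ℝ) + 1) * ∫ x, (oStat x (p + 1) - oStat x p) ∂cubeMeasure n = 1 := by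
  have := isProbabilityMeasure_cubeMeasure (n + 1)
  simpa using integral_gap (G := fun _ => 1) continuous_const (fun _ _ _ => rfl) p

theorem integral_oStat_mul_gap {n : ℕ} (m : Fin n) (p : Fin (n + 1)) :
    ((n : ℝ) + 1) * ∫ x, oStat x (m + 1) * (oStat x (p + 1) - oStat x p) ∂cubeMeasure n =
      ∫ y, oStat y (p.succAbove m + 1) ∂cubeMeasure (n + 1) := by
  rw [integral_gap (G := fun x => oStat x (m + 1)) (continuous_oStat _)
    (fun _ _ h => oStat_congr h _) p]
  refine integral_congr_ae ?_
  filter_upwards with y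
  refine oStat_of_monotone (y := fun i => oStat y (p.succAbove i + 1)) ?_ m
  intro a b hab
  simp only
  rw [← oStat_congr (map_univ_comp_perm y (Tuple.sort y)),
    ← oStat_congr (map_univ_comp_perm y (Tuple.sort y)),
    oStat_of_monotone (Tuple.monotone_sort y), oStat_of_monotone (Tuple.monotone_sort y)]
  exact Tuple.monotone_sort y (p.strictMono_succAbove.monotone hab)

theorem integral_oStat_mul_second_difference {n : ℕ} (m k : Fin n) :
    ((n : ℝ) + 1) * ((n : ℝ) + 2) * ∫ x, oStat x (m + 1) *
      (oStat x (k + 1 + 1) - 2 * oStat x (k + 1) + oStat x k) ∂cubeMeasure n =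
      if m = k then -1 else 0 := by
  have hu := integral_oStat_mul_gap m k.succ
  have hl := integral_oStat_mul_gap m k.castSucc
  have hint : ∀ a b : ℕ, Integrable (fun x : Fin n → ℝ =>
      oStat x (m + 1) * (oStat x a - oStat x b)) (cubeMeasure n) := fun a b =>
    integrable_cubeMeasure
      ((continuous_oStat _).mul ((continuous_oStat _).sub (continuous_oStat _)))
  have hsplit : ∫ x, oStat x (m + 1) *
      (oStat x (k + 1 + 1) - 2 * oStat x (k + 1) + oStat x k) ∂cubeMeasure n =
      ∫ x, oStat x (m + 1) * (oStat x (k + 1 + 1) - oStat x (k + 1)) ∂cubeMeasure n -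
      ∫ x, oStat x (m + 1) * (oStat x (k + 1) - oStat x k) ∂cubeMeasure n := by
    rw [← integral_sub (hint _ _) (hint _ _)]
    congr 1
    ext x
    ring
  simp only [Fin.val_succ, Fin.val_castSucc] at hu hl
  rw [hsplit]
  split_ifs with h
  · subst h
    have hg := integral_oStat_gap (n + 1) m.succ.castSucc
    simp only [Fin.val_succ, Fin.val_castSucc] at hg
    rw [integral_sub (integrable_cubeMeasure (continuous_oStat _))
      (integrable_cubeMeasure (continuous_oStat _))] at hg
    rw [Fin.succAbove_of_castSucc_lt _ _ (Fin.castSucc_lt_succ), Fin.val_castSucc] at hu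
    rw [Fin.succAbove_of_le_castSucc _ _ le_rfl, Fin.val_succ] at hl
    push_cast at hg
    linear_combination ((n : ℝ) + 2) * (hu - hl) - hg
  · have e : k.succ.succAbove m = k.castSucc.succAbove m := by
      rcases lt_or_gt_of_ne h with h | h
      · rw [Fin.succAbove_of_castSucc_lt _ _ (by rw [Fin.lt_def] at *; simp; omega),
          Fin.succAbove_of_castSucc_lt _ _ (by simpa using h)]
      · rw [Fin.succAbove_of_le_castSucc _ _ (by rw [Fin.lt_def] at h; rw [Fin.le_def]; simp; omega),
          Fin.succAbove_of_le_castSucc _ _ (by simpa using h.le)]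
    rw [e] at hu
    linear_combination ((n : ℝ) + 2) * (hu - hl)

theorem integral_oStatS_mul_eq {n : ℕ} {g : (Fin n → ℝ) → ℝ}
    (hg : ∀ (x : Fin n → ℝ) (σ : Equiv.Perm (Fin n)), g (x ∘ σ) = g x) {S T : Finset (Fin n)}
    (hST : #S = #T) (j : ℕ) :
    ∫ x, oStatS S x j * g x ∂cubeMeasure n = ∫ x, oStatS T x j * g x ∂cubeMeasure n := by
  have := isProbabilityMeasure_restrict_Icc
  obtain ⟨σ, rfl⟩ : ∃ σ : Equiv.Perm (Fin n), S.map σ.toEmbedding = T := by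
    refine ⟨(S.equivOfCardEq hST).extendSubtype, Finset.eq_of_subset_of_card_le ?_ ?_⟩
    · intro a ha
      obtain ⟨b, hb, rfl⟩ := Finset.mem_map.1 ha
      exact (S.equivOfCardEq hST).extendSubtype_mem b hb
    · simp [hST]
  have hpres : MeasurePreserving (MeasurableEquiv.piCongrLeft (fun _ : Fin n => ℝ) σ.symm)
      (cubeMeasure n) (cubeMeasure n) :=
    measurePreserving_piCongrLeft (fun _ => volume.restrict (Set.Icc (0 : ℝ) 1)) σ.symm
  rw [← hpres.integral_comp (MeasurableEquiv.measurableEmbedding _)]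
  refine integral_congr_ae ?_
  filter_upwards with x
  have e : MeasurableEquiv.piCongrLeft (fun _ : Fin n => ℝ) σ.symm x = x ∘ σ := by
    ext i
    have h := Equiv.piCongrLeft_apply_apply (fun _ : Fin n => ℝ) σ.symm x (σ i)
    rwa [Equiv.symm_apply_apply] at h
  rw [e, hg, oStatS_map]

theorem stmt15 (n : ℕ) (S : Finset (Fin n)) (hS : S.Nonempty)
    (j : ℕ) (hj : 1 ≤ j) (hjS : j ≤ S.card) (k : ℕ) (hk : 1 ≤ k) (hkn : k ≤ n) :
    infl (fun x => oStatS S x j) k =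
      if j ≤ k ∧ k + S.card ≤ n + j then
        (Nat.choose (k - 1) (j - 1) : ℝ) * (Nat.choose (n - k) (S.card - j) : ℝ) /
          (Nat.choose n S.card : ℝ)
      else 0 := by
  obtain ⟨k, rfl⟩ : ∃ i, k = i + 1 := ⟨k - 1, by omega⟩
  set g : (Fin n → ℝ) → ℝ := fun x => oStat x (k + 1 + 1) - 2 * oStat x (k + 1) + oStat x k
    with hgdef
  have hgc : Continuous g :=
    ((continuous_oStat _).sub (continuous_const.mul (continuous_oStat _))).add (continuous_oStat _)
  have hgs : ∀ (x : Fin n → ℝ) (σ : Equiv.Perm (Fin n)), g (x ∘ σ) = g x := fun x σ => by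
    simp only [hgdef, oStat_congr (map_univ_comp_perm x σ)]
  have hchoose : (n.choose #S : ℝ) ≠ 0 :=
    Nat.cast_ne_zero.2 (Nat.choose_pos (by simpa using S.card_le_univ)).ne'
  set c : Fin n → ℝ := fun m =>
    (((m : ℕ).choose (j - 1) * (n - 1 - m).choose (#S - j) : ℕ) : ℝ) with hc
  have hsym : (n.choose #S : ℝ) * ∫ x, oStatS S x j * g x ∂cubeMeasure n =
      ∑ m : Fin n, c m * ∫ x, oStat x (m + 1) * g x ∂cubeMeasure n := by
    calc (n.choose #S : ℝ) * ∫ x, oStatS S x j * g x ∂cubeMeasure n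
        = ∑ T ∈ powersetCard #S (univ : Finset (Fin n)),
            ∫ x, oStatS T x j * g x ∂cubeMeasure n := by
          rw [Finset.sum_congr rfl fun T hT =>
            integral_oStatS_mul_eq hgs (mem_powersetCard.1 hT).2 j]
          simp
      _ = ∫ x, ∑ T ∈ powersetCard #S (univ : Finset (Fin n)), oStatS T x j * g x
            ∂cubeMeasure n :=
          (integral_finsetSum _ fun T hT => integrable_cubeMeasure
            ((continuous_oStatS T hj (by rwa [(mem_powersetCard.1 hT).2])).mul hgc)).symm
      _ = ∫ x, ∑ m : Fin n, c m * (oStat x (m + 1) * g x) ∂cubeMeasure n := by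
          congr 1
          ext x
          rw [← Finset.sum_mul, sum_oStatS hj hjS, Finset.sum_mul]
          exact Finset.sum_congr rfl fun m _ => mul_assoc _ _ _
      _ = _ := by
          have hint : ∀ m : Fin n, Integrable (fun x => oStat x (m + 1) * g x) (cubeMeasure n) :=
            fun m => integrable_cubeMeasure ((continuous_oStat _).mul hgc)
          rw [integral_finsetSum _ fun m _ => (hint m).const_mul _]
          exact Finset.sum_congr rfl fun m _ => integral_const_mul _ _
  have hsum : ((n : ℝ) + 1) * ((n : ℝ) + 2) *
      ∑ m : Fin n, c m * ∫ x, oStat x (m + 1) * g x ∂cubeMeasure n = -c ⟨k, hkn⟩ := by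
    rw [Finset.mul_sum]
    have : ∀ m : Fin n, ((n : ℝ) + 1) * ((n : ℝ) + 2) *
        (c m * ∫ x, oStat x (m + 1) * g x ∂cubeMeasure n) =
        if m = ⟨k, hkn⟩ then -c m else 0 := fun m => by
      rw [mul_left_comm, integral_oStat_mul_second_difference m ⟨k, hkn⟩]
      split_ifs <;> simp
    simp [this]
  have hinfl : infl (fun x => oStatS S x j) (k + 1) = c ⟨k, hkn⟩ / n.choose #S := by
    rw [infl, restrict_Icc_eq_cubeMeasure, Nat.add_sub_cancel, eq_div_iff hchoose]
    linear_combination -((n : ℝ) + 1) * ((n : ℝ) + 2) * hsym - hsum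
  rw [hinfl]
  simp only [hc, Nat.add_sub_cancel, Nat.cast_mul, show n - 1 - k = n - (k + 1) by omega]
  split_ifs with h
  · rfl
  · rcases not_and_or.1 h with h | h
    · rw [Nat.choose_eq_zero_of_lt (show k < j - 1 by omega)]
      simp
    · rw [Nat.choose_eq_zero_of_lt (show n - (k + 1) < #S - j by omega)]
      simp
end
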